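/- Let v₁, …, v_m be vectors in Lorentzian space ℝ^{n,1} and let v be a lightlike vector of the form v = v_S + v_T, where v_T = (0, …, 0, 1) and ⟨v_S, v_T⟩ = 0, such that ⟨v_i, v⟩ = 0 for all i. Then the vectors w_i = v_i + ⟨v_i, v_T⟩ v − v_T satisfy ⟨w_i, w_j⟩ = ⟨v_i, v_j⟩ − 1 for all i, j and ⟨w_i, v_S⟩ = 0 for all i. -/

import Mathlib

/-- The Lorentzian bilinear form on `ℝ^{n,1}`:
`⟨x,y⟩ = x₁y₁ + ⋯ + xₙyₙ − x_{n+1}y_{n+1}`. -/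
def lorentz {n : ℕ} (x y : Fin (n + 1) → ℝ) : ℝ :=
  (∑ i : Fin n, x i.castSucc * y i.castSucc) - x (Fin.last n) * y (Fin.last n)

section Bilinearity

variable {n : ℕ} (x y z : Fin (n + 1) → ℝ) (c : ℝ)

theorem lorentz_comm : lorentz x y = lorentz y x := by
  simp only [lorentz, mul_comm]

theorem lorentz_add_left : lorentz (x + y) z = lorentz x z + lorentz y z := by
  simp only [lorentz, Pi.add_apply, add_mul, Finset.sum_add_distrib]
  ring

theorem lorentz_smul_left : lorentz (c • x) y = c * lorentz x y := by
  simp only [lorentz, Pi.smul_apply, smul_eq_mul, mul_assoc, ← Finset.mul_sum]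
  ring

theorem lorentz_sub_left : lorentz (x - y) z = lorentz x z - lorentz y z := by
  simp only [lorentz, Pi.sub_apply, sub_mul, Finset.sum_sub_distrib]
  ring

theorem lorentz_add_right : lorentz x (y + z) = lorentz x y + lorentz x z := by
  rw [lorentz_comm, lorentz_add_left, lorentz_comm y, lorentz_comm z]

theorem lorentz_smul_right : lorentz x (c • y) = c * lorentz x y := by
  rw [lorentz_comm, lorentz_smul_left, lorentz_comm y]

theorem lorentz_sub_right : lorentz x (y - z) = lorentz x y - lorentz x z := by
  rw [lorentz_comm, lorentz_sub_left, lorentz_comm y, lorentz_comm z]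

end Bilinearity

/-- if `v = v_S + v_T` is lightlike, where `v_T = (0,…,0,1)` and
`⟨v_S, v_T⟩ = 0`, and `⟨v_i, v⟩ = 0` for all `i`, then the vectors
`w_i = v_i + ⟨v_i, v_T⟩ v − v_T` satisfy `⟨w_i, w_j⟩ = ⟨v_i, v_j⟩ − 1` and
`⟨w_i, v_S⟩ = 0`. -/
theorem stmt17 (n m : ℕ) (v : Fin m → (Fin (n + 1) → ℝ))
    (vS vT w : Fin (n + 1) → ℝ)
    (hvT : vT = fun k => if k = Fin.last n then (1 : ℝ) else 0)
    (hw : w = vS + vT) (hST : lorentz vS vT = 0)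
    (hlight : lorentz w w = 0)
    (horth : ∀ i, lorentz (v i) w = 0) :
    (∀ i j, lorentz (v i + lorentz (v i) vT • w - vT)
        (v j + lorentz (v j) vT • w - vT) = lorentz (v i) (v j) - 1) ∧
      ∀ i, lorentz (v i + lorentz (v i) vT • w - vT) vS = 0 := by
  have hTT : lorentz vT vT = -1 := by
    simp [hvT, lorentz, Fin.castSucc_ne_last]
  have hwT : lorentz w vT = -1 := by
    rw [hw, lorentz_add_left, hST, hTT, zero_add]
  have hTw : lorentz vT w = -1 := by rw [lorentz_comm, hwT]
  have hvS : vS = w - vT := by rw [hw, add_sub_cancel_right]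
  have hwv : ∀ i, lorentz w (v i) = 0 := fun i => by rw [lorentz_comm, horth]
  refine ⟨fun i j => ?_, fun i => ?_⟩
  · simp only [lorentz_sub_left, lorentz_add_left, lorentz_smul_left, lorentz_sub_right,
      lorentz_add_right, lorentz_smul_right, hTT, hwT, hTw, hlight, horth, hwv,
      lorentz_comm vT (v j)]
    ring
  · rw [hvS]
    simp only [lorentz_sub_left, lorentz_add_left, lorentz_smul_left, lorentz_sub_right,
      hTT, hwT, hTw, hlight, horth]
    ring
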